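/- Let H be a bipartite graph on h vertices with hcf(H) = 1, σ(H) = u, w = h − u and u < w. Let 0 < γ < (w−u)/u be a constant. Then there is m_0 such that for every integer m ≥ m_0, every complete bipartite graph G[X,Y] on mh vertices with (1+γ)·u/w ≤ |X|/|Y| ≤ 1 contains an H-factor. -/

import Mathlib

open Finset

attribute [local instance] Classical.propDecidable

namespace BipTiling

variable {α β V : Type*}

/-- A proper 2-coloring of the graph `H`. -/
def Proper2Coloring (H : SimpleGraph α) (c : α → Bool) : Prop :=
  ∀ ⦃a b : α⦄, H.Adj a b → c a ≠ c b

/-- `H` is bipartite, i.e. it admits a proper 2-coloring. -/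
def IsBip (H : SimpleGraph α) : Prop :=
  ∃ c : α → Bool, Proper2Coloring H c

/-- The size of the color class of color `i` under the 2-coloring `c`. -/
noncomputable def colorCard [Fintype α] (c : α → Bool) (i : Bool) : ℕ :=
  (Finset.univ.filter fun v => c v = i).card

/-- `σ(H)`: the smallest size of a color class over all proper 2-colorings of `H`. -/
noncomputable def sigmaBip [Fintype α] (H : SimpleGraph α) : ℕ :=
  sInf {k | ∃ c : α → Bool, Proper2Coloring H c ∧
    k = min (colorCard c true) (colorCard c false)}

/-- The finset of connected components of `H`. -/
noncomputable def comps [Fintype α] (H : SimpleGraph α) : Finset H.ConnectedComponent :=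
  Finset.univ.image H.connectedComponentMk

/-- `c_i`: the number of vertices of the connected component `K`. -/
noncomputable def compCard [Fintype α] (H : SimpleGraph α) (K : H.ConnectedComponent) : ℕ :=
  (Finset.univ.filter fun v => H.connectedComponentMk v = K).card

/-- `d_i = |W_i| - |U_i|`: the (absolute) difference of the sizes of the two color classes
of the component `K`, computed with respect to a proper 2-coloring `c` of `H`.
(For a proper 2-coloring this is independent of the choice of `c`, since the 2-coloring of a
connected bipartite graph is unique up to swapping the colors.) -/
noncomputable def compDiff [Fintype α] (H : SimpleGraph α) (c : α → Bool)
    (K : H.ConnectedComponent) : ℕ :=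
  (((Finset.univ.filter fun v => H.connectedComponentMk v = K ∧ c v = true).card : ℤ) -
    ((Finset.univ.filter fun v => H.connectedComponentMk v = K ∧ c v = false).card : ℤ)).natAbs

/-- `hcf_c(H) = gcd(c_1, …, c_k)`. -/
noncomputable def hcfC [Fintype α] (H : SimpleGraph α) : ℕ :=
  (comps H).gcd (compCard H)

/-- `hcf_{χ,c}(H) = gcd(d_1, …, d_k)`, with respect to a proper 2-coloring `c`. -/
noncomputable def hcfChiC [Fintype α] (H : SimpleGraph α) (c : α → Bool) : ℕ :=
  (comps H).gcd (compDiff H c)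

/-- `x_2 - x_1` for the 2-coloring `c`, where `x_1 ≤ x_2` are the sizes of its color classes. -/
noncomputable def colorDiff [Fintype α] (c : α → Bool) : ℕ :=
  ((colorCard c true : ℤ) - (colorCard c false : ℤ)).natAbs

/-- `hcf_χ(H)`: the gcd of the set `D(H)` of all differences `x_2 - x_1` of color class sizes
over all proper 2-colorings of `H` (`0` represents `∞`, i.e. `D(H) = {0}`). -/
noncomputable def hcfChi [Fintype α] (H : SimpleGraph α) : ℕ :=
  (Finset.univ.filter fun c : α → Bool => Proper2Coloring H c).gcd colorDiff

/-- `hcf(H) = 1` for a bipartite graph `H`: `hcf_c(H) = 1` and `hcf_χ(H) ≤ 2`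
(in particular `hcf_χ(H)` is finite, i.e. nonzero in our encoding). -/
def HcfOne [Fintype α] (H : SimpleGraph α) : Prop :=
  hcfC H = 1 ∧ 0 < hcfChi H ∧ hcfChi H ≤ 2

/-- `f` is a copy of `H` inside `G` (an injective graph homomorphism). -/
def IsCopy (H : SimpleGraph α) (G : SimpleGraph β) (f : α → β) : Prop :=
  Function.Injective f ∧ ∀ ⦃a b : α⦄, H.Adj a b → G.Adj (f a) (f b)

/-- `s` is an `H`-tiling of `G`: a finite collection of pairwise vertex-disjoint copies of `H`. -/
def IsHTiling (H : SimpleGraph α) (G : SimpleGraph β) (s : Finset (α → β)) : Prop :=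
  (∀ f ∈ s, IsCopy H G f) ∧
    ∀ f ∈ s, ∀ g ∈ s, f ≠ g → ∀ a b : α, f a ≠ g b

/-- The set of vertices covered by the tiling `s`. -/
noncomputable def coveredSet [Fintype α] [Fintype β] (s : Finset (α → β)) : Finset β :=
  s.biUnion fun f => Finset.univ.image f

/-- `G` has a perfect `H`-tiling (`H`-factor). -/
def HasHFactor [Fintype α] [Fintype β] (H : SimpleGraph α) (G : SimpleGraph β) : Prop :=
  ∃ s : Finset (α → β), IsHTiling H G s ∧ coveredSet s = Finset.univ

/-- `G` has an `H`-tiling covering all but at most `t` vertices. -/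
def HasHTilingMissingAtMost [Fintype α] [Fintype β] (H : SimpleGraph α) (G : SimpleGraph β)
    (t : ℕ) : Prop :=
  ∃ s : Finset (α → β), IsHTiling H G s ∧ (Finset.univ \ coveredSet s).card ≤ t

/-- `G` is a bipartite graph with partition sets `X` and `Y`, written `G[X,Y]`. -/
structure BipartiteWith [Fintype V] (G : SimpleGraph V) (X Y : Finset V) : Prop where
  disj : Disjoint X Y
  cover : X ∪ Y = Finset.univ
  cross : ∀ ⦃a b : V⦄, G.Adj a b → (a ∈ X ∧ b ∈ Y) ∨ (a ∈ Y ∧ b ∈ X)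

/-- `e(A,B)`: the number of edges of `G` between `A` and `B`. -/
noncomputable def eAB (G : SimpleGraph V) (A B : Finset V) : ℕ :=
  ((A ×ˢ B).filter fun p => G.Adj p.1 p.2).card

/-- The density `d(A,B) = e(A,B)/(|A||B|)`. -/
noncomputable def dens (G : SimpleGraph V) (A B : Finset V) : ℝ :=
  (eAB G A B : ℝ) / ((A.card : ℝ) * (B.card : ℝ))

/-- `|Γ(x) ∩ B|`: the number of neighbors of `x` in `B`. -/
noncomputable def degIn (G : SimpleGraph V) (x : V) (B : Finset V) : ℕ :=
  (B.filter fun y => G.Adj x y).card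

/-- The pair `(X,Y)` is `ε`-regular in `G`. -/
def EpsRegularPair (G : SimpleGraph V) (X Y : Finset V) (ε : ℝ) : Prop :=
  ∀ A ⊆ X, ∀ B ⊆ Y, ε * X.card < A.card → ε * Y.card < B.card →
    |dens G A B - dens G X Y| < ε

/-- The pair `(X,Y)` is `(ε,δ)`-super-regular in `G`. -/
def SuperRegularPair (G : SimpleGraph V) (X Y : Finset V) (ε δ : ℝ) : Prop :=
  EpsRegularPair G X Y ε ∧
    (∀ x ∈ X, δ * Y.card < (degIn G x Y : ℝ)) ∧
    (∀ y ∈ Y, δ * X.card < (degIn G y X : ℝ))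

/-- `G[X,Y]` has an almost `(ε,d,p,q,N)`-cover. -/
def HasAlmostCover [Fintype V] (G : SimpleGraph V) (X Y : Finset V) (ε d : ℝ) (p q N : ℕ) :
    Prop :=
  ∃ (X₀ Y₀ : Finset V) (k : ℕ) (P Q : Fin k → Finset V),
    X₀ ⊆ X ∧ Y₀ ⊆ Y ∧
    (X₀.card : ℝ) ≤ ε * X.card ∧ (Y₀.card : ℝ) ≤ ε * Y.card ∧
    ((X₀ ∪ Y₀) ∪ Finset.univ.biUnion fun i => P i ∪ Q i) = Finset.univ ∧
    (∀ i, Disjoint (X₀ ∪ Y₀) (P i ∪ Q i)) ∧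
    (∀ i j, i ≠ j → Disjoint (P i ∪ Q i) (P j ∪ Q j)) ∧
    (∀ i, Disjoint (P i) (Q i)) ∧
    (∀ i, SuperRegularPair G (P i) (Q i) ε d) ∧
    (∀ i, (P i ⊆ X ∧ Q i ⊆ Y) ∨ (P i ⊆ Y ∧ Q i ⊆ X)) ∧
    (∀ i, q * (P i).card = p * (Q i).card ∧ N * p ≤ (P i).card)

/-- `G[X,Y]` (with `|X| = |Y| = n`) is in the extremal case with parameter `a`:
there are `A ⊆ X`, `B ⊆ Y` with `|A| = |B| = ⌊wn/h⌋` and `d(A,B) ≤ a`. -/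
def ExtremalWith [Fintype V] (G : SimpleGraph V) (X Y : Finset V) (w h : ℕ) (a : ℝ) : Prop :=
  ∃ A ⊆ X, ∃ B ⊆ Y, A.card = w * X.card / h ∧ B.card = w * X.card / h ∧ dens G A B ≤ a

/-- A set of naturals with gcd `1` generates `1` modulo `d > 0` as an additive monoid. -/
theorem exists_list_sum_modEq_one (D : Set ℕ) (d : ℕ) (hd : 0 < d)
    (hg : ∀ g : ℕ, (∀ x ∈ D, g ∣ x) → g = 1) :
    ∃ L : List ℕ, (∀ x ∈ L, x ∈ D) ∧ L.sum ≡ 1 [MOD d] := by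
  have : NeZero d := ⟨hd.ne'⟩
  set S : Set (ZMod d) := (fun x : ℕ => (x : ZMod d)) '' D with hS
  have hmem : (1 : ZMod d) ∈ AddSubgroup.closure S := by
    obtain ⟨z, hz⟩ := Int.subgroup_cyclic
      ((AddSubgroup.closure S).comap (Int.castAddHom (ZMod d)))
    have hz1 : z.natAbs = 1 := by
      refine hg _ fun x hx => ?_
      have hx' : (x : ℤ) ∈ (AddSubgroup.closure S).comap (Int.castAddHom (ZMod d)) := by
        rw [AddSubgroup.mem_comap]
        exact AddSubgroup.subset_closure ⟨x, hx, by simp⟩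
      rw [hz, AddSubgroup.mem_closure_singleton] at hx'
      obtain ⟨n, hn⟩ := hx'
      have : z ∣ (x : ℤ) := ⟨n, by rw [← hn, smul_eq_mul, mul_comm]⟩
      exact Int.natCast_dvd_natCast.1 (Int.natAbs_dvd.2 this)
    have h1 : (1 : ℤ) ∈ (AddSubgroup.closure S).comap (Int.castAddHom (ZMod d)) := by
      rw [hz, AddSubgroup.mem_closure_singleton]
      rcases Int.natAbs_eq z with h | h <;> rw [hz1] at h
      · exact ⟨1, by simp [h]⟩
      · exact ⟨-1, by simp [h]⟩
    simpa [AddSubgroup.mem_comap] using h1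
  have hmem' : (1 : ZMod d) ∈ AddSubmonoid.closure S := by
    rw [← AddSubgroup.closure_toAddSubmonoid_of_finite]
    exact hmem
  obtain ⟨l, hl, hsum⟩ := AddSubmonoid.exists_list_of_mem_closure hmem'
  have key : ∀ l : List (ZMod d), (∀ y ∈ l, y ∈ S) →
      ∃ L : List ℕ, (∀ x ∈ L, x ∈ D) ∧ (L.sum : ZMod d) = l.sum := by
    intro l
    induction l with
    | nil => exact fun _ => ⟨[], by simp, by simp⟩
    | cons y l ih =>
      intro h
      obtain ⟨L, hL, hs⟩ := ih fun z hz => h z (List.mem_cons_of_mem _ hz)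
      obtain ⟨x, hx, hxy⟩ := h y List.mem_cons_self
      refine ⟨x :: L, ?_, ?_⟩
      · intro z hz
        rcases List.mem_cons.1 hz with rfl | hz
        · exact hx
        · exact hL z hz
      · simp only [List.sum_cons, Nat.cast_add, hs]
        exact congrArg (· + l.sum) hxy
  obtain ⟨L, hL, hs⟩ := key l hl
  refine ⟨L, hL, ?_⟩
  rw [← ZMod.natCast_eq_natCast_iff, hs, hsum, Nat.cast_one]

/-- Every large number that is at most half of `m * d` is a sum of
exactly `m` elements of a set with gcd `1`, containing `0` and `d`. -/
theorem exists_list_sum_eq (D : Set ℕ) (d : ℕ) (hd : 0 < d)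
    (hg : ∀ g : ℕ, (∀ x ∈ D, g ∣ x) → g = 1) (h0 : 0 ∈ D) (hdD : d ∈ D) :
    ∃ K : ℕ, ∀ m A : ℕ, K ≤ m → K ≤ A → 2 * A ≤ m * d →
      ∃ L : List ℕ, L.length = m ∧ (∀ x ∈ L, x ∈ D) ∧ L.sum = A := by
  obtain ⟨L, hL, hLs⟩ := exists_list_sum_modEq_one D d hd hg
  refine ⟨2 * (d * L.length) + d * L.sum, fun m A hm hA hmA => ?_⟩
  have hr : A % d < d := Nat.mod_lt _ hd
  have hlen : A % d * L.length ≤ d * L.length := Nat.mul_le_mul_right _ hr.le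
  have hsum : A % d * L.sum ≤ d * L.sum := Nat.mul_le_mul_right _ hr.le
  have hle : A % d * L.sum ≤ A := by omega
  have hmod : A % d * L.sum ≡ A [MOD d] := by
    simpa using (Nat.mod_modEq A d).mul hLs
  obtain ⟨q, hq⟩ := (Nat.modEq_iff_dvd' hle).1 hmod
  have hqm : 2 * q ≤ m := by
    refine Nat.le_of_mul_le_mul_right (c := d) ?_ hd
    calc 2 * q * d = 2 * (d * q) := by ring
      _ ≤ 2 * A := by omega
      _ ≤ m * d := hmA
  have htot : A % d * L.length + q ≤ m := by omega
  refine ⟨(List.replicate (A % d) L).flatten ++ List.replicate q d ++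
    List.replicate (m - (A % d * L.length + q)) 0, ?_, ?_, ?_⟩
  · simp only [List.length_append, List.length_flatten, List.map_replicate, List.sum_replicate,
      List.length_replicate, smul_eq_mul]
    omega
  · intro x hx
    simp only [List.mem_append, List.mem_flatten, List.mem_replicate] at hx
    rcases hx with (⟨l, ⟨_, rfl⟩, hx⟩ | ⟨_, rfl⟩) | ⟨_, rfl⟩
    · exact hL x hx
    · exact hdD
    · exact h0
  · simp only [List.sum_append, List.sum_flatten, List.map_replicate, List.sum_replicate,
      smul_eq_mul, mul_zero, add_zero]
    rw [mul_comm q d]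
    omega

theorem colorCard_true_add_false [Fintype α] (c : α → Bool) :
    colorCard c true + colorCard c false = Fintype.card α := by
  have h := Finset.card_filter_add_card_filter_not (s := (univ : Finset α)) (fun v => c v = true)
  simp only [Bool.not_eq_true] at h
  simpa [colorCard] using h

theorem Proper2Coloring.not {H : SimpleGraph α} {c : α → Bool} (hc : Proper2Coloring H c) :
    Proper2Coloring H fun v => !c v := by
  intro a b hab
  simpa using hc hab

theorem colorCard_not [Fintype α] (c : α → Bool) (i : Bool) :
    colorCard (fun v => !c v) i = colorCard c (!i) := by
  unfold colorCard
  congr 1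
  ext v
  cases c v <;> cases i <;> simp

/-- Swapping the two colors on one connected component. -/
noncomputable def flipOn (H : SimpleGraph α) (K : H.ConnectedComponent) (c : α → Bool) :
    α → Bool :=
  fun v => if H.connectedComponentMk v = K then !c v else c v

theorem Proper2Coloring.flipOn {H : SimpleGraph α} {c : α → Bool} (hc : Proper2Coloring H c)
    (K : H.ConnectedComponent) : Proper2Coloring H (flipOn H K c) := by
  intro a b hab
  have h := hc hab
  have hK : H.connectedComponentMk a = H.connectedComponentMk b :=
    SimpleGraph.ConnectedComponent.connectedComponentMk_eq_of_adj hab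
  unfold BipTiling.flipOn
  rw [hK]
  split_ifs <;> simpa using h

theorem colorCard_flipOn_add [Fintype α] (H : SimpleGraph α) (K : H.ConnectedComponent)
    (c : α → Bool) :
    colorCard (flipOn H K c) true + colorCard c true = compCard H K +
      2 * (univ.filter fun v => H.connectedComponentMk v ≠ K ∧ c v = true).card := by
  simp only [colorCard, compCard, Finset.card_filter, Finset.mul_sum, ← Finset.sum_add_distrib]
  refine Finset.sum_congr rfl fun v _ => ?_
  by_cases hv : H.connectedComponentMk v = K <;> cases hcv : c v <;> simp [flipOn, hv, hcv]

theorem exists_colorCard_eq_sigmaBip [Fintype α] {H : SimpleGraph α} (hbip : IsBip H) :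
    ∃ c, Proper2Coloring H c ∧ colorCard c true = sigmaBip H := by
  obtain ⟨c₀, hc₀⟩ := hbip
  obtain ⟨c, hc, hmin⟩ := Nat.sInf_mem (s := {k | ∃ c : α → Bool, Proper2Coloring H c ∧
    k = min (colorCard c true) (colorCard c false)}) ⟨_, c₀, hc₀, rfl⟩
  rcases le_total (colorCard c true) (colorCard c false) with h | h
  · exact ⟨c, hc, by rw [sigmaBip, hmin, min_eq_left h]⟩
  · exact ⟨_, hc.not, by rw [colorCard_not, sigmaBip, hmin, min_eq_right h]; rfl⟩

theorem sigmaBip_le_colorCard [Fintype α] {H : SimpleGraph α} {c : α → Bool}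
    (hc : Proper2Coloring H c) : sigmaBip H ≤ colorCard c true :=
  by
  refine le_trans (Nat.sInf_le ?_) (min_le_left (colorCard c true) (colorCard c false))
  exact ⟨c, hc, rfl⟩

/-- If `hcf(H) = 1`, the possible sizes of a color class have no common difference. -/
theorem HcfOne.eq_one_of_dvd [Fintype α] {H : SimpleGraph α} (hhcf : HcfOne H) (hbip : IsBip H)
    (g : ℕ) (hg : ∀ c, Proper2Coloring H c → g ∣ colorCard c true - sigmaBip H) : g = 1 := by
  obtain ⟨hC, hpos, hle⟩ := hhcf
  obtain ⟨c₀, hc₀, hc₀u⟩ := exists_colorCard_eq_sigmaBip hbip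
  have hgz : ∀ c, Proper2Coloring H c →
      (g : ℤ) ∣ (colorCard c true : ℤ) - (sigmaBip H : ℤ) := by
    intro c hc
    have h := Int.natCast_dvd_natCast.2 (hg c hc)
    rwa [Nat.cast_sub (sigmaBip_le_colorCard hc)] at h
  have hdvd : g ∣ hcfChi H := by
    refine Finset.dvd_gcd fun c hc => ?_
    have hc' : Proper2Coloring H c := (Finset.mem_filter.1 hc).2
    have h1 := hgz _ hc'
    have h2 := hgz _ hc'.not
    rw [colorCard_not] at h2
    rw [colorDiff, ← Int.natCast_dvd]
    simpa using dvd_sub h1 h2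
  have hg2 : g ≤ 2 := (Nat.le_of_dvd hpos hdvd).trans hle
  have hg0 : 0 < g := Nat.pos_of_dvd_of_pos hdvd hpos
  by_contra hne
  obtain rfl : g = 2 := by omega
  have h2 : 2 ∣ hcfC H := by
    refine Finset.dvd_gcd fun K _ => ?_
    have h1 := hgz _ (hc₀.flipOn K)
    have h3 := colorCard_flipOn_add H K c₀
    push_cast at h1
    omega
  omega

/-- A family of proper 2-colorings whose color classes have total sizes `a` and `b` yields an
`H`-factor of the complete bipartite graph. -/
theorem hasHFactor_of_colorings [Fintype α] (H : SimpleGraph α) {m a b : ℕ}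
    (c : Fin m → α → Bool) (hc : ∀ i, Proper2Coloring H (c i))
    (ha : ∑ i, colorCard (c i) true = a) (hab : a + b = m * Fintype.card α) :
    HasHFactor H (completeBipartiteGraph (Fin a) (Fin b)) := by
  have hcardL : Fintype.card {p : Fin m × α // c p.1 p.2 = true} = a := by
    rw [Fintype.card_subtype, ← ha, Finset.card_filter, Fintype.sum_prod_type]
    simp only [colorCard, Finset.card_filter]
  have hcardR : Fintype.card {p : Fin m × α // ¬ c p.1 p.2 = true} = b := by
    rw [Fintype.card_subtype_compl, hcardL, Fintype.card_prod, Fintype.card_fin]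
    omega
  let E : Fin m × α ≃ Fin a ⊕ Fin b :=
    (Equiv.sumCompl fun p : Fin m × α => c p.1 p.2 = true).symm.trans
      (Equiv.sumCongr (Fintype.equivFinOfCardEq hcardL) (Fintype.equivFinOfCardEq hcardR))
  have hEL : ∀ p : Fin m × α, c p.1 p.2 = true → (E p).isLeft = true := by
    intro p hp
    simp [E, Equiv.sumCompl_symm_apply_of_pos, hp]
  have hER : ∀ p : Fin m × α, c p.1 p.2 = false → (E p).isRight = true := by
    intro p hp
    simp [E, Equiv.sumCompl_symm_apply_of_neg, hp]
  refine ⟨univ.image fun i v => E (i, v), ⟨?_, ?_⟩, ?_⟩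
  · intro f hf
    obtain ⟨i, -, rfl⟩ := Finset.mem_image.1 hf
    refine ⟨fun v v' h => (Prod.ext_iff.1 (E.injective h)).2, fun x y hxy => ?_⟩
    have hne := hc i hxy
    rw [completeBipartiteGraph_adj]
    cases hx : c i x <;> cases hy : c i y
    · simp [hx, hy] at hne
    · exact Or.inr ⟨hER (i, x) hx, hEL (i, y) hy⟩
    · exact Or.inl ⟨hEL (i, x) hx, hER (i, y) hy⟩
    · simp [hx, hy] at hne
  · intro f hf g hg hfg x y hxy
    obtain ⟨i, -, rfl⟩ := Finset.mem_image.1 hf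
    obtain ⟨j, -, rfl⟩ := Finset.mem_image.1 hg
    obtain rfl : i = j := (Prod.ext_iff.1 (E.injective hxy)).1
    exact hfg rfl
  · refine Finset.eq_univ_of_forall fun y => ?_
    simp only [coveredSet, Finset.mem_biUnion, Finset.mem_image, Finset.mem_univ, true_and]
    exact ⟨_, ⟨(E.symm y).1, rfl⟩, (E.symm y).2, by simp⟩

/-- The smaller part of the bipartition exceeds `m * u` by a linear amount. -/
theorem linear_excess_of_ratio {u w γ a b m : ℝ} (hu : 0 < u) (hw : 0 < w) (hγ : 0 < γ)
    (hb : 0 < b) (hab : a + b = m * (u + w)) (h : (1 + γ) * u / w ≤ a / b) :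
    m * (u * γ * w / (w + (1 + γ) * u)) ≤ a - m * u := by
  rw [div_le_div_iff₀ hw hb] at h
  have hpos : 0 < w + (1 + γ) * u := by positivity
  rw [← mul_div_assoc, div_le_iff₀ hpos]
  obtain rfl : b = m * (u + w) - a := by linarith
  nlinarith

/-- Corollary 3.7. Let `H` be a bipartite graph on `h` vertices with
`hcf(H) = 1`, `u = σ(H) < w = h - u`, and let `0 < γ < (w-u)/u`. Then for every sufficiently
large `m`, every complete bipartite graph on `mh` vertices with part sizes `a ≤ b` satisfying
`(1+γ)u/w ≤ a/b ≤ 1` contains an `H`-factor. -/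
theorem statement_9 {α : Type*} [Fintype α] (H : SimpleGraph α) (h u w : ℕ)
    (hh : Fintype.card α = h) (hbip : IsBip H) (hhcf : HcfOne H)
    (hu : u = sigmaBip H) (hw : w = h - u) (huw : u < w)
    (γ : ℝ) (hγ0 : 0 < γ) (hγ1 : γ < ((w : ℝ) - (u : ℝ)) / (u : ℝ)) :
    ∃ m₀ : ℕ, ∀ m : ℕ, m₀ ≤ m → ∀ a b : ℕ, a + b = m * h →
      (1 + γ) * (u : ℝ) / (w : ℝ) ≤ (a : ℝ) / (b : ℝ) → (a : ℝ) / (b : ℝ) ≤ 1 →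
      HasHFactor H (completeBipartiteGraph (Fin a) (Fin b)) := by
  have hu0 : 0 < u := by
    rcases Nat.eq_zero_or_pos u with rfl | h
    · simp only [Nat.cast_zero, div_zero] at hγ1
      exact absurd hγ1 hγ0.le.not_gt
    · exact h
  have hhuw : h = u + w := by omega
  obtain ⟨c₀, hc₀, hc₀u⟩ := exists_colorCard_eq_sigmaBip hbip
  have hc₀w : colorCard (fun v => !c₀ v) true = w := by
    have := colorCard_true_add_false c₀
    rw [colorCard_not, Bool.not_true]
    omega
  obtain ⟨K, hK⟩ := exists_list_sum_eq
    {x | ∃ c, Proper2Coloring H c ∧ colorCard c true = u + x} (w - u) (by omega)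
    (fun g hg => hhcf.eq_one_of_dvd hbip g fun c hc => hg _ ⟨c, hc, by
      have := sigmaBip_le_colorCard hc
      omega⟩)
    ⟨c₀, hc₀, by omega⟩ ⟨_, hc₀.not, by omega⟩
  have huR : (0 : ℝ) < u := Nat.cast_pos.2 hu0
  have hwR : (0 : ℝ) < w := Nat.cast_pos.2 (hu0.trans huw)
  set ε : ℝ := u * γ * w / (w + (1 + γ) * u) with hε
  have hε0 : 0 < ε := by positivity
  obtain ⟨M, hM⟩ := exists_nat_ge ((K : ℝ) / ε)
  refine ⟨max K M, fun m hm a b hab hlow hup => ?_⟩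
  have hb : 0 < b := by
    rcases Nat.eq_zero_or_pos b with rfl | hb
    · have : 0 < (1 + γ) * (u : ℝ) / w := by positivity
      simp only [Nat.cast_zero, div_zero] at hlow
      exact absurd hlow this.not_ge
    · exact hb
  have hbR : (0 : ℝ) < b := Nat.cast_pos.2 hb
  have hle : a ≤ b := by
    rw [div_le_one hbR] at hup
    exact_mod_cast hup
  have hexc := linear_excess_of_ratio (m := m) huR hwR hγ0 hbR
    (by rw [hhuw] at hab; exact_mod_cast hab) hlow
  have hMm : (M : ℝ) ≤ m := Nat.cast_le.2 ((le_max_right _ _).trans hm)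
  have hKm : (K : ℝ) ≤ m * ε := (div_le_iff₀ hε0).1 (hM.trans hMm)
  have hKa : K + m * u ≤ a := by
    have : (K : ℝ) + m * u ≤ a := by linarith
    exact_mod_cast this
  have hhalf : 2 * (a - m * u) ≤ m * (w - u) := by
    obtain ⟨d, rfl⟩ := Nat.exists_eq_add_of_lt huw
    have : u + d + 1 - u = d + 1 := by omega
    rw [this]
    have h2 : m * h = 2 * (m * u) + m * (d + 1) := by rw [hhuw]; ring
    omega
  obtain ⟨L, hLm, hLD, hLs⟩ := hK m (a - m * u) ((le_max_left _ _).trans hm) (by omega) hhalf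
  subst hLm
  choose c hc hcu using fun i : Fin L.length => hLD _ (L.get_mem i)
  refine hasHFactor_of_colorings H c hc ?_ (by rw [hh, hab])
  simp only [hcu, Finset.sum_add_distrib, Finset.sum_const, Finset.card_univ, Fintype.card_fin,
    smul_eq_mul]
  have : ∑ i : Fin L.length, L.get i = L.sum := by
    simp [Fin.sum_univ_getElem]
  omega

end BipTiling
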